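/- Let X and Y be probabilistic coherence spaces and let s, s' ∈ P(!X⊸Y). If the associated functions coincide on P(X), that is, if ŝ(u) = ŝ'(u) for all u ∈ P(X) where ŝ(u)_b = Σ_{m∈Mfin(|X|)} s_{m,b} u^m, then s = s' as matrices (they have the same coefficients at every (m,b)). -/

import Mathlib

open scoped ENNReal NNReal Classical

noncomputable section

namespace PCS

variable {I J K : Type*}

/-- Pairing `⟨u,u'⟩ = Σ_a u_a u'_a`, valued in `[0,∞]`. -/
def pair (u u' : I → ℝ≥0) : ℝ≥0∞ := ∑' a, (u a : ℝ≥0∞) * (u' a : ℝ≥0∞)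

/-- Orthogonal of a set of nonnegative families. -/
def orth (F : Set (I → ℝ≥0)) : Set (I → ℝ≥0) := {u' | ∀ u ∈ F, pair u u' ≤ 1}

/-- `P` is (the set of vectors of) a probabilistic coherence space on the web `I`. -/
structure IsPCS (P : Set (I → ℝ≥0)) : Prop where
  biorth : orth (orth P) = P
  pos : ∀ a : I, ∃ u ∈ P, 0 < u a
  bdd : ∀ a : I, ∃ A : ℝ≥0, 0 < A ∧ ∀ u ∈ P, u a ≤ A

/-- Application of a matrix to a vector: `(t·u)_b = Σ_a t_{a,b} u_a ∈ [0,∞]`. -/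
def matApp (t : I × J → ℝ≥0) (u : I → ℝ≥0) : J → ℝ≥0∞ :=
  fun b => ∑' a, (t (a, b) : ℝ≥0∞) * (u a : ℝ≥0∞)

/-- Application for `[0,∞]`-valued matrices/vectors. -/
def matAppE (t : I × J → ℝ≥0∞) (u : I → ℝ≥0∞) : J → ℝ≥0∞ :=
  fun b => ∑' a, t (a, b) * u a

/-- A `[0,∞]`-valued vector belongs to `Q ⊆ (ℝ≥0)^J` if it is pointwise the coercion of
an element of `Q` (in particular it is everywhere finite). -/
def memP (Q : Set (J → ℝ≥0)) (v : J → ℝ≥0∞) : Prop :=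
  ∃ w ∈ Q, ∀ b, v b = (w b : ℝ≥0∞)

/-- `t` is a morphism from `(I,P)` to `(J,Q)`: `t·u ∈ Q` for every `u ∈ P`. -/
def IsMorphism (t : I × J → ℝ≥0) (P : Set (I → ℝ≥0)) (Q : Set (J → ℝ≥0)) : Prop :=
  ∀ u ∈ P, memP Q (matApp t u)

/-- Matrix composition `(t ∘ s)_{a,c} = Σ_b s_{a,b} t_{b,c}`, in `[0,∞]`. -/
def matComp (s : I × J → ℝ≥0) (t : J × K → ℝ≥0) : I × K → ℝ≥0∞ :=
  fun p => ∑' b, (s (p.1, b) : ℝ≥0∞) * (t (b, p.2) : ℝ≥0∞)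

/-- Composition of `[0,∞]`-valued matrices. -/
def matCompE (s : I × J → ℝ≥0∞) (t : J × K → ℝ≥0∞) : I × K → ℝ≥0∞ :=
  fun p => ∑' b, s (p.1, b) * t (b, p.2)

/-- Set of simple tensors `u⊗v` with `u ∈ P`, `v ∈ Q`. -/
def tensSet (P : Set (I → ℝ≥0)) (Q : Set (J → ℝ≥0)) : Set (I × J → ℝ≥0) :=
  {w | ∃ u ∈ P, ∃ v ∈ Q, w = fun p => u p.1 * v p.2}

/-- `P(X⊗Y)`: biorthogonal closure of the simple tensors. -/
def tensorP (P : Set (I → ℝ≥0)) (Q : Set (J → ℝ≥0)) : Set (I × J → ℝ≥0) :=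
  orth (orth (tensSet P Q))

/-- `P(X⊸Y) = P((X ⊗ Y⊥)⊥)`. -/
def limplP (P : Set (I → ℝ≥0)) (Q : Set (J → ℝ≥0)) : Set (I × J → ℝ≥0) :=
  orth (tensorP P (orth Q))

/-- Norm `‖u‖_X = sup{⟨u,u'⟩ : u' ∈ P(X)⊥}`. -/
def normE (P : Set (I → ℝ≥0)) (u : I → ℝ≥0) : ℝ≥0∞ :=
  ⨆ u' ∈ orth P, pair u u'

/-- The product `&_{i} X_i`. -/
def withP {ι : Type*} {A : ι → Type*} (P : ∀ i, Set (A i → ℝ≥0)) :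
    Set ((Σ i, A i) → ℝ≥0) :=
  {u | ∀ i, (fun a => u ⟨i, a⟩) ∈ P i}

/-- The coproduct `⊕_{i} X_i = (&_{i} X_i⊥)⊥`. -/
def plusP {ι : Type*} {A : ι → Type*} (P : ∀ i, Set (A i → ℝ≥0)) :
    Set ((Σ i, A i) → ℝ≥0) :=
  orth (withP fun i => orth (P i))

/-- Projection matrix `π_i`. -/
def projMat {ι : Type*} {A : ι → Type*} (i : ι) : ((Σ j, A j) × A i) → ℝ≥0 :=
  fun p => if p.1 = ⟨i, p.2⟩ then 1 else 0

/-- Injection matrix `in_j`. -/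
def injMat {ι : Type*} {A : ι → Type*} (j : ι) : (A j × Σ i, A i) → ℝ≥0 :=
  fun p => if p.2 = ⟨j, p.1⟩ then 1 else 0

/-- `u^m = Π_a u_a^{m(a)}`. -/
def mpow (u : I → ℝ≥0) (m : Multiset I) : ℝ≥0 := (m.map u).prod

/-- `v^m` for `[0,∞]`-valued `v`. -/
def mpowE (v : I → ℝ≥0∞) (m : Multiset I) : ℝ≥0∞ := (m.map v).prod

/-- Promotion `u^! = (u^m)_m`. -/
def promote (u : I → ℝ≥0) : Multiset I → ℝ≥0 := fun m => mpow u m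

/-- `P(!X)`: biorthogonal closure of the promotions. -/
def bangP (P : Set (I → ℝ≥0)) : Set (Multiset I → ℝ≥0) :=
  orth (orth {v | ∃ u ∈ P, v = promote u})

/-- The function associated with a matrix `s ∈ (ℝ≥0)^{Mfin(I)×J}`:
`ŝ(u)_b = Σ_m s_{m,b} u^m`. -/
def fhat (s : Multiset I × J → ℝ≥0) (u : I → ℝ≥0) : J → ℝ≥0∞ :=
  fun b => ∑' m : Multiset I, (s (m, b) : ℝ≥0∞) * (mpow u m : ℝ≥0∞)

/-- Factorial of a multiset: `m! = Π_a m(a)!`. -/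
def mfact [DecidableEq I] (m : Multiset I) : ℕ :=
  (m.dedup.map fun a => (m.count a).factorial).prod

/-- Multisets over `I × J` with first marginal `c` and second marginal `d`. -/
def marg (c : Multiset I) (d : Multiset J) : Set (Multiset (I × J)) :=
  {r | r.map Prod.fst = c ∧ r.map Prod.snd = d}

/-- The exponential of a matrix: `(!t)_{c,d} = Σ_{r ∈ L(c,d)} (d!/r!) t^r`. -/
def bangMatE [DecidableEq I] [DecidableEq J] (t : I × J → ℝ≥0∞) :
    Multiset I × Multiset J → ℝ≥0∞ :=
  fun p => ∑' r : marg p.1 p.2,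
    ((mfact p.2 : ℝ≥0∞) / (mfact r.1 : ℝ≥0∞)) * mpowE t r.1

/-- A real power series that is summable at `1` and vanishes on `(0,1]` is zero. -/
theorem coeff_eq_zero_of_tsum_eq_zero (n : ℕ) : ∀ c : ℕ → ℝ, Summable (fun k => |c k|) →
    (∀ t : ℝ, 0 < t → t ≤ 1 → ∑' k, c k * t ^ k = 0) → c n = 0 := by
  have abs_le (c : ℕ → ℝ) (t : ℝ) (ht : 0 < t) (ht1 : t ≤ 1) (k : ℕ) :
      |c k * t ^ k| ≤ |c k| := by
    rw [abs_mul, abs_of_nonneg (pow_nonneg ht.le k)]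
    exact mul_le_of_le_one_right (abs_nonneg _) (pow_le_one₀ ht.le ht1)
  have summ (c : ℕ → ℝ) (hc : Summable fun k => |c k|) (t : ℝ) (ht : 0 < t) (ht1 : t ≤ 1) :
      Summable fun k => |c k * t ^ k| :=
    Summable.of_nonneg_of_le (fun _ => abs_nonneg _) (abs_le c t ht ht1) hc
  have split (c : ℕ → ℝ) (hc : Summable fun k => |c k|)
      (h : ∀ t : ℝ, 0 < t → t ≤ 1 → ∑' k, c k * t ^ k = 0) (t : ℝ) (ht : 0 < t) (ht1 : t ≤ 1) :
      c 0 + t * ∑' k, c (k + 1) * t ^ k = 0 := by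
    rw [← h t ht ht1, (summ c hc t ht ht1).of_abs.tsum_eq_zero_add, ← tsum_mul_left]
    congr 1
    · simp
    · exact tsum_congr fun k => by ring
  have zero (c : ℕ → ℝ) (hc : Summable fun k => |c k|)
      (h : ∀ t : ℝ, 0 < t → t ≤ 1 → ∑' k, c k * t ^ k = 0) : c 0 = 0 := by
    have hc' : Summable fun k => |c (k + 1)| := (summable_nat_add_iff 1).2 hc
    have bound : ∀ t : ℝ, 0 < t → t ≤ 1 → |c 0| ≤ t * ∑' k, |c (k + 1)| := by
      intro t ht ht1
      have hs : Summable fun k => |c (k + 1) * t ^ k| := summ _ hc' t ht ht1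
      have habs : |∑' k, c (k + 1) * t ^ k| ≤ ∑' k, |c (k + 1) * t ^ k| := by
        simp only [← Real.norm_eq_abs] at hs ⊢
        exact norm_tsum_le_tsum_norm hs
      rw [eq_neg_of_add_eq_zero_left (split c hc h t ht ht1), abs_neg, abs_mul, abs_of_pos ht]
      refine mul_le_mul_of_nonneg_left ?_ ht.le
      exact habs.trans <| hs.tsum_le_tsum (abs_le (fun k => c (k + 1)) t ht ht1) hc'
    have lim : Filter.Tendsto (fun t : ℝ => t * ∑' k, |c (k + 1)|)
        (nhdsWithin 0 (Set.Ioi 0)) (nhds 0) := by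
      have : Continuous fun t : ℝ => t * ∑' k, |c (k + 1)| := by fun_prop
      simpa using (this.tendsto 0).mono_left nhdsWithin_le_nhds
    refine abs_nonpos_iff.1 (ge_of_tendsto lim ?_)
    filter_upwards [Ioc_mem_nhdsGT (zero_lt_one' ℝ)] with t ht using bound t ht.1 ht.2
  induction n with
  | zero => exact zero
  | succ n ih =>
    intro c hc h
    refine ih (fun k => c (k + 1)) ((summable_nat_add_iff 1).2 hc) fun t ht ht1 => ?_
    have := split c hc h t ht ht1
    rw [zero c hc h, zero_add] at this
    exact (mul_eq_zero.1 this).resolve_left ht.ne'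

/-- Uniqueness of the coefficients of a power series with coefficients in `[0,∞]`
that converges at `1`. -/
theorem coeff_eq_of_tsum_eq (A B : ℕ → ℝ≥0∞) (hA : ∑' n, A n ≠ ∞) (hB : ∑' n, B n ≠ ∞)
    (h : ∀ t : ℝ≥0, t ≤ 1 → ∑' n, A n * (t : ℝ≥0∞) ^ n = ∑' n, B n * (t : ℝ≥0∞) ^ n)
    (n : ℕ) : A n = B n := by
  have finite (C : ℕ → ℝ≥0∞) (hC : ∑' n, C n ≠ ∞) (t : ℝ≥0) (ht : t ≤ 1) :
      ∑' n, C n * (t : ℝ≥0∞) ^ n ≠ ∞ :=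
    ne_top_of_le_ne_top hC <| ENNReal.tsum_le_tsum fun k =>
      mul_le_of_le_one_right' (pow_le_one' (by exact_mod_cast ht) k)
  have summ (C : ℕ → ℝ≥0∞) (hC : ∑' n, C n ≠ ∞) (t : ℝ≥0) (ht : t ≤ 1) :
      Summable fun n => (C n).toReal * (t : ℝ) ^ n := by
    simpa using ENNReal.summable_toReal (finite C hC t ht)
  have eval (C : ℕ → ℝ≥0∞) (hC : ∑' n, C n ≠ ∞) (t : ℝ≥0) (ht : t ≤ 1) :
      ∑' n, (C n).toReal * (t : ℝ) ^ n = (∑' n, C n * (t : ℝ≥0∞) ^ n).toReal := by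
    rw [ENNReal.tsum_toReal_eq (ENNReal.ne_top_of_tsum_ne_top (finite C hC t ht))]
    simp
  have key := coeff_eq_zero_of_tsum_eq_zero n (fun k => (A k).toReal - (B k).toReal)
    ((ENNReal.summable_toReal hA).sub (ENNReal.summable_toReal hB)).abs (by
      intro t ht ht1
      lift t to ℝ≥0 using ht.le
      have ht1' : t ≤ 1 := by exact_mod_cast ht1
      simp only [sub_mul]
      rw [(summ A hA t ht1').tsum_sub (summ B hB t ht1'), eval A hA t ht1', eval B hB t ht1',
        h t ht1', sub_self])
  exact (ENNReal.toReal_eq_toReal_iff' (ENNReal.ne_top_of_tsum_ne_top hA n)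
    (ENNReal.ne_top_of_tsum_ne_top hB n)).1 (sub_eq_zero.1 key)

theorem mpow_smul (t : ℝ≥0) (x : I → ℝ≥0) (m : Multiset I) :
    mpow (fun a => t * x a) m = mpow x m * t ^ m.card := by
  simp [mpow, Multiset.prod_map_mul, mul_comm]

theorem mpow_congr {x y : I → ℝ≥0} {m : Multiset I} (h : ∀ a ∈ m, x a = y a) :
    mpow x m = mpow y m := by
  rw [mpow, mpow, Multiset.map_congr rfl h]

theorem mpow_eq_zero {x : I → ℝ≥0} {m : Multiset I} {a : I} (ha : a ∈ m) (hx : x a = 0) :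
    mpow x m = 0 :=
  Multiset.prod_eq_zero (Multiset.mem_map.2 ⟨a, ha, hx⟩)

theorem fhat_smul (s : Multiset I × J → ℝ≥0) (t : ℝ≥0) (x : I → ℝ≥0) (b : J) :
    fhat s (fun a => t * x a) b =
      ∑' n : ℕ, (∑' m : Multiset.card (α := I) ⁻¹' {n},
        (s (m, b) : ℝ≥0∞) * (mpow x m : ℝ≥0∞)) * (t : ℝ≥0∞) ^ n := by
  rw [fhat, ← ENNReal.tsum_fiberwise _ (Multiset.card (α := I))]
  refine tsum_congr fun n => ?_
  rw [← ENNReal.tsum_mul_right]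
  refine tsum_congr fun m => ?_
  have hm : Multiset.card m.1 = n := m.2
  rw [mpow_smul, hm]
  push_cast
  ring

theorem subset_orth_orth (F : Set (I → ℝ≥0)) : F ⊆ orth (orth F) := by
  intro u hu v hv
  have : pair v u = pair u v := tsum_congr fun a => mul_comm _ _
  exact this.trans_le (hv u hu)

/-- The orthogonal of a probabilistic coherence space has a vector that is positive at `b`. -/
theorem IsPCS.exists_mem_orth_pos {Q : Set (J → ℝ≥0)} (hQ : IsPCS Q) (b : J) :
    ∃ v ∈ orth Q, 0 < v b := by
  obtain ⟨A, hA, hbd⟩ := hQ.bdd b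
  refine ⟨Pi.single b A⁻¹, fun u hu => ?_, by simpa using hA⟩
  rw [pair, tsum_eq_single b (fun a ha => by simp [ha])]
  rw [Pi.single_eq_same]
  norm_cast
  exact mul_inv_le_one_of_le₀ (hbd u hu) zero_le

theorem fhat_ne_top {P : Set (I → ℝ≥0)} {Q : Set (J → ℝ≥0)} (hQ : IsPCS Q)
    {s : Multiset I × J → ℝ≥0} (hs : s ∈ limplP (bangP P) Q) {u : I → ℝ≥0} (hu : u ∈ P)
    (b : J) : fhat s u b ≠ ∞ := by
  obtain ⟨v, hv, hvb⟩ := hQ.exists_mem_orth_pos b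
  have hle : pair (fun p : Multiset I × J => promote u p.1 * v p.2) s ≤ 1 :=
    hs _ (subset_orth_orth _ ⟨_, subset_orth_orth _ ⟨u, hu, rfl⟩, v, hv, rfl⟩)
  have hmul : fhat s u b * (v b : ℝ≥0∞) ≤ 1 := by
    refine le_trans ?_ hle
    rw [fhat, ← ENNReal.tsum_mul_right, pair]
    refine le_trans (le_of_eq (tsum_congr fun m => ?_)) (ENNReal.tsum_comp_le_tsum_of_injective
      (Prod.mk_left_injective b) _)
    simp only [promote]
    push_cast
    ring
  intro htop
  rw [htop, ENNReal.top_mul (by exact_mod_cast hvb.ne')] at hmul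
  exact absurd hmul (by simp)

/-- On a finite set of coordinates, a probabilistic coherence space contains a box with
nonempty interior. -/
theorem IsPCS.exists_box {P : Set (I → ℝ≥0)} (hP : IsPCS P) (S : Finset I) :
    ∃ δ : I → ℝ≥0, (∀ a, 0 < δ a) ∧
      ∀ x : I → ℝ≥0, (∀ a, x a ≤ δ a) → (∀ a ∉ S, x a = 0) → x ∈ P := by
  choose w hwP hw using hP.pos
  refine ⟨fun a => w a a / (S.card + 1), fun a => div_pos (hw a) (by positivity), ?_⟩
  intro x hx hxS
  rw [← hP.biorth]
  intro v hv
  have hvw (a : I) : w a a * v a ≤ 1 := by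
    have : ((w a a : ℝ≥0∞) * v a) ≤ 1 := (ENNReal.le_tsum a).trans (hv _ (hwP a))
    exact_mod_cast this
  rw [pair, tsum_eq_sum (s := S) (fun a ha => by simp [hxS a ha])]
  norm_cast
  calc ∑ a ∈ S, v a * x a ≤ ∑ a ∈ S, 1 / ((S.card : ℝ≥0) + 1) := by
        refine Finset.sum_le_sum fun a _ => ?_
        calc v a * x a ≤ v a * (w a a / (S.card + 1)) := by gcongr; exact hx a
          _ = w a a * v a / (S.card + 1) := by ring
          _ ≤ 1 / (S.card + 1) := by gcongr; exact hvw a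
    _ = S.card / ((S.card : ℝ≥0) + 1) := by simp [div_eq_mul_inv]
    _ ≤ 1 := div_le_one_of_le₀ (by simp) zero_le

/-- Multisets of cardinality `n` with elements in `S`. -/
def multisetsOn (S : Finset I) (n : ℕ) : Finset (Multiset I) :=
  (Finset.Iic (n • S.val)).filter fun m => Multiset.card m = n

theorem mem_multisetsOn {S : Finset I} {n : ℕ} {m : Multiset I} :
    m ∈ multisetsOn S n ↔ Multiset.card m = n ∧ ∀ a ∈ m, a ∈ S := by
  rw [multisetsOn, Finset.mem_filter, Finset.mem_Iic, and_comm, and_congr_right_iff]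
  rintro rfl
  refine ⟨fun h a ha => Multiset.mem_of_mem_nsmul (Multiset.mem_of_le h ha), fun h => ?_⟩
  rw [Multiset.le_iff_count]
  intro a
  by_cases ha : a ∈ m
  · rw [Multiset.count_nsmul, Multiset.count_eq_one_of_mem S.nodup (h a ha), mul_one]
    exact Multiset.count_le_card a m
  · simp [Multiset.count_eq_zero_of_notMem ha]

theorem tsum_card_eq_sum (f : Multiset I → ℝ≥0) (S : Finset I) (n : ℕ) {x : I → ℝ≥0}
    (hx : ∀ a ∉ S, x a = 0) :
    ∑' m : Multiset.card (α := I) ⁻¹' {n}, (f m : ℝ≥0∞) * (mpow x m : ℝ≥0∞) =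
      ((∑ m ∈ multisetsOn S n, f m * mpow x m : ℝ≥0) : ℝ≥0∞) := by
  rw [tsum_subtype (Multiset.card (α := I) ⁻¹' {n})
      (fun m => (f m : ℝ≥0∞) * (mpow x m : ℝ≥0∞)), tsum_eq_sum (s := multisetsOn S n)]
  · push_cast
    refine Finset.sum_congr rfl fun m hm => ?_
    exact Set.indicator_of_mem (by exact (mem_multisetsOn.1 hm).1) _
  · intro m hm
    refine Set.indicator_apply_eq_zero.2 fun hn => ?_
    have : ∃ a ∈ m, a ∉ S := by
      by_contra! hcon
      exact hm (mem_multisetsOn.2 ⟨hn, hcon⟩)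
    obtain ⟨a, ha, haS⟩ := this
    simp [mpow_eq_zero ha (hx a haS)]

theorem eval_monomial_toFinsupp (x : I → ℝ≥0) (m : Multiset I) (c : ℝ) :
    MvPolynomial.eval (fun a => (x a : ℝ)) (MvPolynomial.monomial (Multiset.toFinsupp m) c) =
      c * (mpow x m : ℝ) := by
  rw [MvPolynomial.eval_monomial, mpow, Finset.prod_multiset_map_count]
  push_cast
  rfl

/-- A finite family of coefficients indexed by multisets is determined by the values of the
associated polynomial on a box. -/
theorem coeff_eq_of_sum_mpow_eq (T : Finset (Multiset I)) (f g : Multiset I → ℝ≥0)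
    (δ : I → ℝ≥0) (hδ : ∀ a, 0 < δ a)
    (h : ∀ x : I → ℝ≥0, (∀ a, x a ≤ δ a) →
      ∑ m ∈ T, f m * mpow x m = ∑ m ∈ T, g m * mpow x m)
    {m : Multiset I} (hm : m ∈ T) : f m = g m := by
  let p (f : Multiset I → ℝ≥0) : MvPolynomial I ℝ :=
    ∑ m ∈ T, MvPolynomial.monomial (Multiset.toFinsupp m) (f m : ℝ)
  have coeff_p (f : Multiset I → ℝ≥0) : (p f).coeff (Multiset.toFinsupp m) = f m := by
    simp [p, MvPolynomial.coeff_sum, MvPolynomial.coeff_monomial, hm]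
  have hp : p f = p g := by
    refine MvPolynomial.funext_set (fun a => Set.Icc (0 : ℝ) (δ a))
      (fun a => Set.Icc_infinite (by exact_mod_cast hδ a)) fun x hx => ?_
    lift x to I → ℝ≥0 using fun a => (hx a trivial).1
    simp only [p, map_sum, eval_monomial_toFinsupp]
    exact_mod_cast h x fun a => by exact_mod_cast (hx a trivial).2
  have := congrArg (MvPolynomial.coeff (Multiset.toFinsupp m)) hp
  rw [coeff_p, coeff_p] at this
  exact_mod_cast this

/-- Theorem 3.10: two elements of `P(!X⊸Y)` whose associated functions agree on `P(X)`
are equal as matrices. -/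
theorem fhat_injective {I J : Type*} [Countable I] [Countable J]
    (P : Set (I → ℝ≥0)) (Q : Set (J → ℝ≥0)) (hP : IsPCS P) (hQ : IsPCS Q)
    (s s' : Multiset I × J → ℝ≥0)
    (hs : s ∈ limplP (bangP P) Q) (hs' : s' ∈ limplP (bangP P) Q)
    (h : ∀ u ∈ P, ∀ b, fhat s u b = fhat s' u b) :
    s = s' := by
  funext ⟨m₀, b⟩
  obtain ⟨δ, hδ, hbox⟩ := hP.exists_box m₀.toFinset
  refine coeff_eq_of_sum_mpow_eq (multisetsOn m₀.toFinset (Multiset.card m₀))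
    (fun m => s (m, b)) (fun m => s' (m, b)) δ hδ (fun x hx => ?_)
    (mem_multisetsOn.2 ⟨rfl, fun a ha => Multiset.mem_toFinset.2 ha⟩)
  let y : I → ℝ≥0 := fun a => if a ∈ m₀.toFinset then x a else 0
  have hy0 : ∀ a ∉ m₀.toFinset, y a = 0 := fun a ha => if_neg ha
  have hyx : ∀ a, y a ≤ x a := fun a => by
    simp only [y]
    split_ifs <;> simp
  have hxy : ∀ m ∈ multisetsOn m₀.toFinset (Multiset.card m₀), mpow x m = mpow y m :=
    fun m hm => mpow_congr fun a ha => (if_pos ((mem_multisetsOn.1 hm).2 a ha)).symm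
  have hyP : ∀ t : ℝ≥0, t ≤ 1 → (fun a => t * y a) ∈ P := fun t ht =>
    hbox _ (fun a => (mul_le_of_le_one_left' ht).trans ((hyx a).trans (hx a)))
      fun a ha => by simp [hy0 a ha]
  have hfin {r : Multiset I × J → ℝ≥0} (hr : r ∈ limplP (bangP P) Q) :
      ∑' n : ℕ, ∑' m : Multiset.card (α := I) ⁻¹' {n},
        (r (m, b) : ℝ≥0∞) * (mpow y m : ℝ≥0∞) ≠ ∞ := by
    have := fhat_ne_top hQ hr (hyP 1 le_rfl) b
    rw [fhat_smul] at this
    simpa using this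
  have key := coeff_eq_of_tsum_eq _ _ (hfin hs) (hfin hs')
    (fun t ht => by rw [← fhat_smul, ← fhat_smul, h _ (hyP t ht)]) (Multiset.card m₀)
  rw [tsum_card_eq_sum (fun m => s (m, b)) _ _ hy0,
    tsum_card_eq_sum (fun m => s' (m, b)) _ _ hy0, ENNReal.coe_inj] at key
  rw [Finset.sum_congr rfl fun m hm => by rw [hxy m hm], key]
  exact Finset.sum_congr rfl fun m hm => by rw [hxy m hm]

end PCS
end
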